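/- arXiv:2411.09614 — 6 statements merged into one kernel-verified Lean document; each statement's English description precedes it below -/
import Mathlib

section
/- Let n be a positive natural number, K > 0, and let α be real with (n-2)/4 < α < n/4; set a := 2α - n/2 + 1 (so 0 < a < 1). Define F₁(ρ) := ∫₀^{1/(2K)} s^{2α - n/2} e^{-ρs} ds + ∫_{1/(2K)}^∞ (1 + Ks)^{-3/2} e^{-ρs} ds. Then ρ^a · F₁(ρ) → Γ(a) as ρ → ∞, where Γ is the real Gamma function. In particular F₁(ρ) is asymptotically a nonzero constant multiple of (1/ρ)^{2α - n/2 + 1} as ρ → ∞. -/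
open MeasureTheory Real Set Filter

/-- A Laplace-type integral of a bounded function over `(c, ∞)` with `c > 0` decays faster than
any power. -/
theorem tendsto_rpow_mul_integral_Ioi_mul_exp_neg {g : ℝ → ℝ} {C c : ℝ} (a : ℝ) (hc : 0 < c)
    (hg : ∀ s ∈ Ioi c, |g s| ≤ C) :
    Tendsto (fun ρ : ℝ => ρ ^ a * ∫ s in Ioi c, g s * Real.exp (-ρ * s)) atTop (nhds 0) := by
  have hlim : Tendsto (fun ρ : ℝ => C * (ρ ^ a * Real.exp (-c * ρ))) atTop (nhds 0) := by
    simpa using (tendsto_rpow_mul_exp_neg_mul_atTop_nhds_zero a c hc).const_mul C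
  refine squeeze_zero_norm' ?_ hlim
  filter_upwards [eventually_ge_atTop 1] with ρ hρ
  have hρ0 : 0 < ρ := one_pos.trans_le hρ
  have hC : 0 ≤ C := (abs_nonneg _).trans (hg (c + 1) (by simp))
  have hbound : ‖∫ s in Ioi c, g s * Real.exp (-ρ * s)‖ ≤
      ∫ s in Ioi c, C * Real.exp (-ρ * s) := by
    refine norm_integral_le_of_norm_le
      ((integrableOn_exp_mul_Ioi (neg_lt_zero.2 hρ0) c).const_mul C) ?_
    filter_upwards [ae_restrict_mem measurableSet_Ioi] with s hs
    rw [norm_mul, Real.norm_eq_abs, Real.norm_eq_abs, Real.abs_exp]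
    gcongr
    exact hg s hs
  rw [integral_const_mul, integral_exp_mul_Ioi (neg_lt_zero.2 hρ0), neg_div_neg_eq] at hbound
  rw [norm_mul, Real.norm_of_nonneg (by positivity)]
  calc ρ ^ a * ‖∫ s in Ioi c, g s * Real.exp (-ρ * s)‖
      ≤ ρ ^ a * (C * (Real.exp (-ρ * c) / ρ)) := by gcongr
    _ ≤ ρ ^ a * (C * Real.exp (-ρ * c)) := by
        gcongr
        exact div_le_self (Real.exp_pos _).le hρ
    _ = C * (ρ ^ a * Real.exp (-c * ρ)) := by
        rw [show -ρ * c = -c * ρ by ring]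
        ring

/-- The Gamma integral with rate `ρ`, split at a point `c ≥ 0`. -/
theorem integral_Ioc_add_integral_Ioi_rpow_mul_exp_neg {a ρ c : ℝ} (ha : 0 < a) (hρ : 0 < ρ)
    (hc : 0 ≤ c) :
    (∫ s in Ioc 0 c, s ^ (a - 1) * Real.exp (-ρ * s)) +
      ∫ s in Ioi c, s ^ (a - 1) * Real.exp (-ρ * s) = (1 / ρ) ^ a * Real.Gamma a := by
  have hint : IntegrableOn (fun s : ℝ => s ^ (a - 1) * Real.exp (-ρ * s)) (Ioi 0) := by
    simpa using integrableOn_rpow_mul_exp_neg_mul_rpow (s := a - 1) (p := 1) (b := ρ)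
      (by linarith) one_pos hρ
  rw [← Real.integral_rpow_mul_exp_neg_mul_Ioi ha hρ, ← Ioc_union_Ioi_eq_Ioi hc,
    setIntegral_union (Ioc_disjoint_Ioi le_rfl) measurableSet_Ioi]
  · simp only [neg_mul]
  · simpa only [neg_mul] using hint.mono_set Ioc_subset_Ioi_self
  · simpa only [neg_mul] using hint.mono_set (Ioi_subset_Ioi hc)



/-- Large-`ρ` asymptotic of `F₁` (Lemma 3.9(b), case i = 1): with `a = 2α - n/2 + 1 ∈ (0,1)`,
`ρ^a · F₁(ρ) → Γ(a)` as `ρ → ∞`, i.e. `F₁(ρ)` is asymptotically a nonzero constant multiple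
of `(1/ρ)^{2α - n/2 + 1}`. -/
theorem F1_asymptotic (n : ℕ) (hn : 0 < n) (K α a : ℝ) (hK : 0 < K)
    (h1 : ((n : ℝ) - 2) / 4 < α) (h2 : α < (n : ℝ) / 4)
    (ha : a = 2 * α - (n : ℝ) / 2 + 1)
    (F : ℝ → ℝ)
    (hF : ∀ ρ : ℝ, F ρ =
      (∫ s in Ioc (0:ℝ) (1 / (2 * K)), s ^ (2 * α - (n : ℝ) / 2) * Real.exp (-ρ * s)) +
      ∫ s in Ioi (1 / (2 * K)), (1 + K * s) ^ (-(3:ℝ) / 2) * Real.exp (-ρ * s)) :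
    Tendsto (fun ρ : ℝ => ρ ^ a * F ρ) atTop (nhds (Real.Gamma a)) := by
  have ha0 : 0 < a := by linarith
  have ha1 : a - 1 < 0 := by linarith
  have hc : 0 < 1 / (2 * K) := by positivity
  have hpow : ∀ s ∈ Ioi (1 / (2 * K)), |s ^ (a - 1)| ≤ (1 / (2 * K)) ^ (a - 1) := by
    intro s hs
    rw [abs_of_nonneg (rpow_nonneg (hc.trans hs).le _)]
    exact rpow_le_rpow_of_nonpos hc (le_of_lt hs) ha1.le
  have hone : ∀ s ∈ Ioi (1 / (2 * K)), |(1 + K * s) ^ (-(3:ℝ) / 2)| ≤ 1 := by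
    intro s hs
    have hs0 : 0 < K * s := mul_pos hK (hc.trans hs)
    rw [abs_of_nonneg (by positivity)]
    exact rpow_le_one_of_one_le_of_nonpos (by linarith) (by norm_num)
  have hlim := ((tendsto_rpow_mul_integral_Ioi_mul_exp_neg a hc hone).sub
    (tendsto_rpow_mul_integral_Ioi_mul_exp_neg a hc hpow)).const_add (Real.Gamma a)
  rw [sub_zero, add_zero] at hlim
  refine hlim.congr' ?_
  filter_upwards [eventually_gt_atTop 0] with ρ hρ
  have hsplit := integral_Ioc_add_integral_Ioi_rpow_mul_exp_neg ha0 hρ hc.le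
  have hmul : ρ ^ a * (1 / ρ) ^ a = 1 := by
    rw [← mul_rpow hρ.le (by positivity), mul_one_div_cancel hρ.ne', one_rpow]
  rw [hF, show 2 * α - (n : ℝ) / 2 = a - 1 by linarith]
  linear_combination (-ρ ^ a) * hsplit - Real.Gamma a * hmul
end

section
/- Let K > 0. Define F₂(ρ) := ∫₀^{1/(2K)} (ln s)² e^{-ρs} ds + ∫_{1/(2K)}^∞ (1 + Ks)^{-3/2} e^{-ρs} ds. Then (ρ / (ln ρ)²) · F₂(ρ) → 1 as ρ → ∞; that is, F₂(ρ) is asymptotically equal to (ln ρ)²/ρ as ρ → ∞. -/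
open MeasureTheory Real Set Filter

lemma integrableOn_one_add_abs_log_sq_mul_exp_neg :
    IntegrableOn (fun u : ℝ => (1 + |Real.log u|) ^ 2 * Real.exp (-u)) (Ioi 0) := by
  have h1 := (Real.GammaIntegral_convergent (s := 1) (by norm_num)).const_mul 3
  have h2 := (Real.GammaIntegral_convergent (s := 3 / 2) (by norm_num)).const_mul 48
  have h3 := (Real.GammaIntegral_convergent (s := 1 / 2) (by norm_num)).const_mul 48
  refine Integrable.mono' ((h1.add h2).add h3) (Measurable.aestronglyMeasurable (by fun_prop)) ?_
  refine (ae_restrict_iff' measurableSet_Ioi).2 (Eventually.of_forall fun u hu => ?_)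
  have hu : 0 < u := hu
  have hsq (t : ℝ) : (u ^ t) ^ 2 = u ^ (t * 2) := by
    rw [← Real.rpow_natCast, ← Real.rpow_mul hu.le]; norm_num
  have hprod : u ^ (1 / 4 : ℝ) * u ^ (-(1 / 4) : ℝ) = 1 := by
    rw [← Real.rpow_add hu]; norm_num
  have hp := Real.rpow_pos_of_pos hu (1 / 4)
  have hq := Real.rpow_pos_of_pos hu (-(1 / 4))
  have ha := Real.log_le_rpow_div hu.le (ε := 1 / 4) (by norm_num)
  have hb := Real.log_le_rpow_div (inv_pos.2 hu).le (ε := 1 / 4) (by norm_num)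
  rw [Real.log_inv, Real.inv_rpow hu.le, ← Real.rpow_neg hu.le] at hb
  have hs1 := hsq (1 / 4)
  have hs2 := hsq (-(1 / 4))
  norm_num at hs1 hs2 ha hb hp hq hprod
  have key : (1 + |Real.log u|) ^ 2 ≤
      3 + 48 * u ^ (1 / 2 : ℝ) + 48 * u ^ (-(1 / 2) : ℝ) := by
    rw [← hs1, ← hs2]
    rcases abs_cases (Real.log u) with ⟨h, h0⟩ | ⟨h, h0⟩ <;> rw [h]
    · nlinarith [sq_nonneg (1 - 4 * u ^ (1 / 4 : ℝ)), sq_nonneg (u ^ (-(1 / 4) : ℝ))]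
    · nlinarith [sq_nonneg (1 - 4 * u ^ (-(1 / 4) : ℝ)), sq_nonneg (u ^ (1 / 4 : ℝ))]
  rw [Real.norm_of_nonneg (by positivity)]
  refine (mul_le_mul_of_nonneg_right key (Real.exp_pos _).le).trans (le_of_eq ?_)
  simp only [Pi.add_apply]
  norm_num
  ring

lemma setIntegral_log_sq_mul_exp_eq {a ρ : ℝ} (hρ : 1 < ρ) :
    ρ / (Real.log ρ) ^ 2 * ∫ s in Ioc 0 a, (Real.log s) ^ 2 * Real.exp (-ρ * s) =
      ∫ u in Ioi 0, (Iic (ρ * a)).indicator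
        (fun u => (1 - Real.log u / Real.log ρ) ^ 2 * Real.exp (-u)) u := by
  have h0 : 0 < ρ := by linarith
  have hl : 0 < Real.log ρ := Real.log_pos hρ
  have h := integral_comp_mul_left_Ioi ((Iic (ρ * a)).indicator
        (fun u => (1 - Real.log u / Real.log ρ) ^ 2 * Real.exp (-u))) 0 h0
  rw [mul_zero, smul_eq_mul, eq_inv_mul_iff_mul_eq₀ h0.ne'] at h
  rw [← h, ← Ioi_inter_Iic, ← setIntegral_indicator measurableSet_Iic, div_eq_mul_inv, mul_assoc,
    ← integral_const_mul]
  congr 1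
  refine setIntegral_congr_fun measurableSet_Ioi fun s hs => ?_
  have hs : 0 < s := hs
  simp only [indicator_apply, mem_Iic, mul_le_mul_iff_right₀ h0]
  split_ifs
  · rw [Real.log_mul h0.ne' hs.ne', neg_mul]
    field_simp
    ring
  · simp

lemma tendsto_setIntegral_log_sq_mul_exp {a : ℝ} (ha : 0 < a) :
    Tendsto (fun ρ : ℝ => ρ / (Real.log ρ) ^ 2 *
      ∫ s in Ioc 0 a, (Real.log s) ^ 2 * Real.exp (-ρ * s)) atTop (nhds 1) := by
  have hlim : Tendsto (fun ρ : ℝ => ∫ u in Ioi 0, (Iic (ρ * a)).indicator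
      (fun u => (1 - Real.log u / Real.log ρ) ^ 2 * Real.exp (-u)) u) atTop
      (nhds (∫ u in Ioi (0 : ℝ), Real.exp (-u))) := by
    refine tendsto_integral_filter_of_dominated_convergence _ ?_ ?_
      integrableOn_one_add_abs_log_sq_mul_exp_neg ?_
    · refine Eventually.of_forall fun ρ => ?_
      exact (Measurable.indicator (by fun_prop) measurableSet_Iic).aestronglyMeasurable
    · filter_upwards [eventually_ge_atTop (Real.exp 1)] with ρ hρ
      have hl : 1 ≤ Real.log ρ := (Real.le_log_iff_exp_le ((Real.exp_pos 1).trans_le hρ)).2 hρ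
      refine Eventually.of_forall fun u => (norm_indicator_le_norm_self _ _).trans ?_
      rw [Real.norm_of_nonneg (by positivity)]
      gcongr ?_ * _
      refine sq_le_sq.2 ?_
      rw [abs_of_nonneg (a := 1 + |Real.log u|) (by positivity)]
      refine (abs_sub _ _).trans ?_
      rw [abs_one, abs_div, abs_of_pos (by linarith : 0 < Real.log ρ)]
      gcongr
      exact div_le_self (abs_nonneg _) hl
    · refine Eventually.of_forall fun u => ?_
      have h1 : Tendsto (fun ρ : ℝ => (1 - Real.log u / Real.log ρ) ^ 2 * Real.exp (-u)) atTop
          (nhds (Real.exp (-u))) := by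
        simpa using (((Real.tendsto_log_atTop.const_div_atTop (Real.log u)).const_sub 1).pow
          2).mul_const (Real.exp (-u))
      refine h1.congr' ?_
      filter_upwards [eventually_ge_atTop (u / a)] with ρ hρ
      rw [indicator_of_mem]
      exact (div_le_iff₀ ha).1 hρ
  rw [integral_exp_neg_Ioi_zero] at hlim
  refine hlim.congr' ?_
  filter_upwards [eventually_gt_atTop 1] with ρ hρ
  exact (setIntegral_log_sq_mul_exp_eq hρ).symm

lemma tendsto_setIntegral_Ioi_mul_exp {a : ℝ} (ha : 0 < a) {g : ℝ → ℝ}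
    (hg : ∀ s ∈ Ioi a, |g s| ≤ 1) :
    Tendsto (fun ρ : ℝ => ρ / (Real.log ρ) ^ 2 *
      ∫ s in Ioi a, g s * Real.exp (-ρ * s)) atTop (nhds 0) := by
  refine squeeze_zero_norm' (a := fun ρ => ((Real.log ρ) ^ 2)⁻¹) ?_
    (tendsto_inv_atTop_zero.comp ((tendsto_pow_atTop two_ne_zero).comp Real.tendsto_log_atTop))
  filter_upwards [eventually_gt_atTop 1] with ρ hρ
  have h0 : 0 < ρ := by linarith
  have hbound : ‖∫ s in Ioi a, g s * Real.exp (-ρ * s)‖ ≤ ∫ s in Ioi a, Real.exp (-ρ * s) := by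
    refine norm_integral_le_of_norm_le (integrableOn_exp_mul_Ioi (by linarith) a) ?_
    refine (ae_restrict_iff' measurableSet_Ioi).2 (Eventually.of_forall fun s hs => ?_)
    rw [norm_mul, Real.norm_of_nonneg (Real.exp_pos _).le]
    exact mul_le_of_le_one_left (Real.exp_pos _).le (hg s hs)
  rw [integral_exp_mul_Ioi (by linarith), neg_div_neg_eq] at hbound
  have hexp : Real.exp (-ρ * a) ≤ 1 := Real.exp_le_one_iff.2 (by nlinarith)
  rw [norm_mul, Real.norm_of_nonneg (by positivity)]
  calc ρ / (Real.log ρ) ^ 2 * ‖∫ s in Ioi a, g s * Real.exp (-ρ * s)‖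
      ≤ ρ / (Real.log ρ) ^ 2 * (1 / ρ) := by
        gcongr
        exact hbound.trans (by gcongr)
    _ = ((Real.log ρ) ^ 2)⁻¹ := by field_simp

/-- Large-`ρ` asymptotic of `F₂` (Lemma 3.9(b), case i = 2):
`(ρ / (ln ρ)²) · F₂(ρ) → 1` as `ρ → ∞`, i.e. `F₂(ρ)` is asymptotically `(ln ρ)²/ρ`. -/
theorem F2_asymptotic (K : ℝ) (hK : 0 < K)
    (F : ℝ → ℝ)
    (hF : ∀ ρ : ℝ, F ρ =
      (∫ s in Ioc (0:ℝ) (1 / (2 * K)), (Real.log s) ^ 2 * Real.exp (-ρ * s)) +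
      ∫ s in Ioi (1 / (2 * K)), (1 + K * s) ^ (-(3:ℝ) / 2) * Real.exp (-ρ * s)) :
    Tendsto (fun ρ : ℝ => ρ / (Real.log ρ) ^ 2 * F ρ) atTop (nhds 1) := by
  have ha : 0 < 1 / (2 * K) := by positivity
  have htail : ∀ s ∈ Ioi (1 / (2 * K)), |(1 + K * s) ^ (-(3:ℝ) / 2)| ≤ 1 := fun s hs => by
    have hKs : 0 < K * s := mul_pos hK (ha.trans hs)
    rw [abs_of_nonneg (by positivity)]
    exact Real.rpow_le_one_of_one_le_of_nonpos (by linarith) (by norm_num)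
  have h := (tendsto_setIntegral_log_sq_mul_exp ha).add (tendsto_setIntegral_Ioi_mul_exp ha htail)
  rw [add_zero] at h
  refine h.congr fun ρ => ?_
  rw [hF, mul_add]
end

section
/- Let n be a positive natural number, let b > 0, K > 0, and let α be real with 0 < α < n/4. Then there exists a constant C > 0 such that for every t with 0 < t ≤ 1/(2K), ∫₀^∞ s^{α-1} (t+s)^{-n/4} (1 + 2K(t+s))^{(n-3)/4} e^{-bK(t+s)} ds ≤ C e^{-bKt} t^{α - n/4}, and for every t ≥ 1/(2K), ∫₀^∞ s^{α-1} (t+s)^{-n/4} (1 + 2K(t+s))^{(n-3)/4} e^{-bK(t+s)} ds ≤ C e^{-bKt} (1 + Kt)^{-3/4}. -/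
open MeasureTheory Real Set

lemma integrableOn_Ioi_rpow_mul_one_add_rpow {a m : ℝ} (ha : 0 < a) (ham : a < m) :
    IntegrableOn (fun u : ℝ => u ^ (a - 1) * (1 + u) ^ (-m)) (Ioi 0) := by
  have hmeas : Measurable (fun u : ℝ => u ^ (a - 1) * (1 + u) ^ (-m)) := by fun_prop
  rw [← Ioc_union_Ioi_eq_Ioi (zero_le_one' ℝ)]
  refine IntegrableOn.union ?_ ?_
  · have h : IntegrableOn (fun u : ℝ => u ^ (a - 1)) (Ioc 0 1) :=
      (intervalIntegrable_iff_integrableOn_Ioc_of_le zero_le_one).1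
        (intervalIntegral.intervalIntegrable_rpow' (by linarith))
    refine Integrable.mono' h hmeas.aestronglyMeasurable ?_
    refine (ae_restrict_iff' measurableSet_Ioc).2 (.of_forall fun u hu => ?_)
    have hu0 : 0 < u := hu.1
    rw [norm_of_nonneg (by positivity)]
    exact mul_le_of_le_one_right (by positivity)
      (rpow_le_one_of_one_le_of_nonpos (by linarith) (by linarith))
  · have h : IntegrableOn (fun u : ℝ => u ^ (a - 1 - m)) (Ioi 1) :=
      integrableOn_Ioi_rpow_of_lt (by linarith) one_pos
    refine Integrable.mono' h hmeas.aestronglyMeasurable ?_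
    refine (ae_restrict_iff' measurableSet_Ioi).2 (.of_forall fun u hu => ?_)
    have hu0 : 0 < u := one_pos.trans hu
    rw [norm_of_nonneg (by positivity), sub_eq_add_neg (a - 1) m, rpow_add hu0]
    exact mul_le_mul_of_nonneg_left
      (rpow_le_rpow_of_nonpos hu0 (by linarith) (by linarith)) (by positivity)

lemma rpow_mul_add_rpow_eq {a m t s : ℝ} (ht : 0 < t) (hs : 0 < s) :
    s ^ (a - 1) * (t + s) ^ (-m) =
      t ^ (a - 1 - m) * ((t⁻¹ * s) ^ (a - 1) * (1 + t⁻¹ * s) ^ (-m)) := by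
  have h1 : s = t * (t⁻¹ * s) := by field_simp
  have h2 : t + s = t * (1 + t⁻¹ * s) := by field_simp
  have h3 : 0 < t⁻¹ * s := by positivity
  rw [h2, mul_rpow ht.le (by positivity), sub_eq_add_neg (a - 1) m, rpow_add ht]
  nth_rewrite 1 [h1]
  rw [mul_rpow ht.le h3.le]
  ring

lemma integrableOn_Ioi_rpow_mul_add_rpow {a m t : ℝ} (ha : 0 < a) (ham : a < m) (ht : 0 < t) :
    IntegrableOn (fun s : ℝ => s ^ (a - 1) * (t + s) ^ (-m)) (Ioi 0) := by
  have h := (integrableOn_Ioi_comp_mul_left_iff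
    (fun u : ℝ => u ^ (a - 1) * (1 + u) ^ (-m)) 0 (inv_pos.2 ht)).2
    (by simpa using integrableOn_Ioi_rpow_mul_one_add_rpow ha ham)
  exact IntegrableOn.congr_fun (h.const_mul (t ^ (a - 1 - m)))
    (fun s hs => (rpow_mul_add_rpow_eq ht hs).symm) measurableSet_Ioi

lemma integral_Ioi_rpow_mul_add_rpow {a m t : ℝ} (ht : 0 < t) :
    ∫ s in Ioi (0 : ℝ), s ^ (a - 1) * (t + s) ^ (-m) =
      t ^ (a - m) * ∫ u in Ioi (0 : ℝ), u ^ (a - 1) * (1 + u) ^ (-m) := by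
  rw [setIntegral_congr_fun measurableSet_Ioi fun s hs => rpow_mul_add_rpow_eq ht hs,
    integral_const_mul,
    integral_comp_mul_left_Ioi (fun u : ℝ => u ^ (a - 1) * (1 + u) ^ (-m)) 0 (inv_pos.2 ht),
    mul_zero, inv_inv, smul_eq_mul, ← mul_assoc, ← rpow_add_one ht.ne']
  congr 2
  ring

/-- On bounded times the polynomial factor is absorbed by the exponential decay in `s`. -/
lemma one_add_rpow_mul_exp_le (n : ℕ) {b K t s : ℝ} (hb : 0 < b) (hK : 0 < K) (ht : 0 < t)
    (htK : t ≤ 1 / (2 * K)) (hs : 0 < s) :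
    (1 + 2 * K * (t + s)) ^ (((n : ℝ) - 3) / 4) * exp (-b * K * (t + s)) ≤
      n.factorial * (2 / b) ^ n * exp b * exp (-b * K * t) := by
  have hKt : 2 * K * t ≤ 1 := by
    rw [le_div_iff₀ (by positivity)] at htK
    linarith
  have hn : (0 : ℝ) ≤ n := n.cast_nonneg
  have hKs : 0 < K * s := by positivity
  have hbase : 1 ≤ 1 + 2 * K * (t + s) := le_add_of_nonneg_right (by positivity)
  have h1 : (1 + 2 * K * (t + s)) ^ (((n : ℝ) - 3) / 4) ≤ (2 + 2 * K * s) ^ n := calc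
    _ ≤ (1 + 2 * K * (t + s)) ^ (n : ℝ) := rpow_le_rpow_of_exponent_le hbase (by linarith)
    _ = (1 + 2 * K * (t + s)) ^ n := rpow_natCast _ _
    _ ≤ _ := pow_le_pow_left₀ (by linarith) (by linarith) n
  have h2 : (2 + 2 * K * s) ^ n ≤ n.factorial * (2 / b) ^ n * exp (b + b * K * s) := by
    have h := pow_div_factorial_le_exp (b + b * K * s) (by positivity) n
    rw [div_le_iff₀ (by positivity)] at h
    have he : 2 + 2 * K * s = 2 / b * (b + b * K * s) := by field_simp
    rw [he, mul_pow]
    calc _ ≤ (2 / b) ^ n * (exp (b + b * K * s) * n.factorial) := by gcongr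
      _ = _ := by ring
  calc _ ≤ n.factorial * (2 / b) ^ n * exp (b + b * K * s) * exp (-b * K * (t + s)) := by
        gcongr
        exact h1.trans h2
    _ = _ := by
        rw [mul_assoc, ← exp_add, mul_assoc _ (exp b), ← exp_add]
        ring_nf

/-- For large arguments the two power factors combine to the power `-3/4`. -/
lemma rpow_mul_one_add_rpow_le (n : ℕ) {K t s : ℝ} (hK : 0 < K)
    (htK : 1 / (2 * K) ≤ t) (hs : 0 < s) :
    (t + s) ^ (-(n : ℝ) / 4) * (1 + 2 * K * (t + s)) ^ (((n : ℝ) - 3) / 4) ≤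
      (4 * K) ^ ((n : ℝ) / 4) * (1 + K * t) ^ (-(3 : ℝ) / 4) := by
  have ht : 0 < t := lt_of_lt_of_le (by positivity) htK
  have hKt : 1 ≤ 2 * K * t := by
    rw [div_le_iff₀ (by positivity)] at htK
    linarith
  have hn : (0 : ℝ) ≤ n := n.cast_nonneg
  have hKs : 0 < K * s := by positivity
  have hKt0 : 0 < K * t := by positivity
  set B := 1 + 2 * K * (t + s) with hB
  have hB0 : 0 < B := by positivity
  have h1 : (t + s) ^ (-(n : ℝ) / 4) ≤ (4 * K) ^ ((n : ℝ) / 4) * B ^ (-(n : ℝ) / 4) := by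
    have hle : B / (4 * K) ≤ t + s := by
      rw [div_le_iff₀ (by positivity)]
      linarith
    refine (rpow_le_rpow_of_nonpos (by positivity) hle (by linarith)).trans_eq ?_
    rw [div_rpow hB0.le (by positivity), neg_div, rpow_neg (by positivity : 0 ≤ 4 * K),
      div_inv_eq_mul, mul_comm]
  calc _ ≤ (4 * K) ^ ((n : ℝ) / 4) * B ^ (-(n : ℝ) / 4) * B ^ (((n : ℝ) - 3) / 4) := by gcongr
    _ = (4 * K) ^ ((n : ℝ) / 4) * B ^ (-(3 : ℝ) / 4) := by
        rw [mul_assoc, ← rpow_add hB0]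
        ring_nf
    _ ≤ _ := mul_le_mul_of_nonneg_left
        (rpow_le_rpow_of_nonpos (by positivity) (by linarith) (by norm_num)) (by positivity)

/-- Integral estimate underlying Lemma 2.8, regime `0 < α < n/4`. -/
theorem integral_estimate_subcritical (n : ℕ) (hn : 0 < n) (b K α : ℝ)
    (hb : 0 < b) (hK : 0 < K) (hα0 : 0 < α) (hα : α < (n : ℝ) / 4) :
    ∃ C > (0:ℝ),
      (∀ t : ℝ, 0 < t → t ≤ 1 / (2 * K) →
        (∫ s in Ioi (0:ℝ), s ^ (α - 1) * (t + s) ^ (-(n : ℝ) / 4) *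
            (1 + 2 * K * (t + s)) ^ (((n : ℝ) - 3) / 4) * Real.exp (-b * K * (t + s)))
          ≤ C * Real.exp (-b * K * t) * t ^ (α - (n : ℝ) / 4)) ∧
      (∀ t : ℝ, 1 / (2 * K) ≤ t →
        (∫ s in Ioi (0:ℝ), s ^ (α - 1) * (t + s) ^ (-(n : ℝ) / 4) *
            (1 + 2 * K * (t + s)) ^ (((n : ℝ) - 3) / 4) * Real.exp (-b * K * (t + s)))
          ≤ C * Real.exp (-b * K * t) * (1 + K * t) ^ (-(3:ℝ) / 4)) := by
  set I := ∫ u in Ioi (0 : ℝ), u ^ (α - 1) * (1 + u) ^ (-((n : ℝ) / 4)) with hI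
  set J := ∫ s in Ioi (0 : ℝ), s ^ (α - 1) * exp (-(b * K) * s) with hJ
  have hI0 : 0 ≤ I := setIntegral_nonneg measurableSet_Ioi fun u (hu : 0 < u) => by positivity
  have hJ0 : 0 ≤ J := setIntegral_nonneg measurableSet_Ioi fun u (hu : 0 < u) => by positivity
  set D := n.factorial * (2 / b) ^ n * exp b with hD
  set E := (4 * K) ^ ((n : ℝ) / 4) with hE
  have hD0 : 0 < D := by positivity
  have hE0 : 0 < E := by positivity
  have hJint : IntegrableOn (fun s : ℝ => s ^ (α - 1) * exp (-(b * K) * s)) (Ioi 0) := by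
    simpa using integrableOn_rpow_mul_exp_neg_mul_rpow (p := 1) (s := α - 1) (b := b * K)
      (by linarith) one_pos (by positivity)
  refine ⟨D * I + E * J + 1, by positivity, fun t ht htK => ?_, fun t htK => ?_⟩
  · have hint := (integrableOn_Ioi_rpow_mul_add_rpow hα0 hα ht).const_mul
      (D * exp (-b * K * t))
    calc _ ≤ ∫ s in Ioi (0 : ℝ),
          D * exp (-b * K * t) * (s ^ (α - 1) * (t + s) ^ (-((n : ℝ) / 4))) := by
          refine integral_mono_of_nonneg ?_ hint ?_
          · exact (ae_restrict_iff' measurableSet_Ioi).2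
              (.of_forall fun s (hs : 0 < s) => by dsimp only [Pi.zero_apply]; positivity)
          · refine (ae_restrict_iff' measurableSet_Ioi).2 (.of_forall fun s (hs : 0 < s) => ?_)
            dsimp only
            rw [← neg_div, mul_assoc, mul_comm (D * _)]
            exact mul_le_mul_of_nonneg_left (one_add_rpow_mul_exp_le n hb hK ht htK hs)
              (by positivity)
      _ = D * I * exp (-b * K * t) * t ^ (α - (n : ℝ) / 4) := by
          rw [integral_const_mul, integral_Ioi_rpow_mul_add_rpow ht]
          ring
      _ ≤ _ := by
          gcongr
          nlinarith [mul_nonneg hE0.le hJ0]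
  · have ht : 0 < t := lt_of_lt_of_le (by positivity) htK
    have hint := hJint.const_mul (E * (1 + K * t) ^ (-(3 : ℝ) / 4) * exp (-b * K * t))
    calc _ ≤ ∫ s in Ioi (0 : ℝ), E * (1 + K * t) ^ (-(3 : ℝ) / 4) * exp (-b * K * t) *
            (s ^ (α - 1) * exp (-(b * K) * s)) := by
          refine integral_mono_of_nonneg ?_ hint ?_
          · exact (ae_restrict_iff' measurableSet_Ioi).2
              (.of_forall fun s (hs : 0 < s) => by dsimp only [Pi.zero_apply]; positivity)
          · refine (ae_restrict_iff' measurableSet_Ioi).2 (.of_forall fun s (hs : 0 < s) => ?_)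
            have hexp : exp (-b * K * (t + s)) = exp (-b * K * t) * exp (-(b * K) * s) := by
              rw [← exp_add]
              ring_nf
            dsimp only
            rw [hexp]
            calc _ = (t + s) ^ (-(n : ℝ) / 4) * (1 + 2 * K * (t + s)) ^ (((n : ℝ) - 3) / 4) *
                  (s ^ (α - 1) * (exp (-b * K * t) * exp (-(b * K) * s))) := by ring
              _ ≤ E * (1 + K * t) ^ (-(3 : ℝ) / 4) *
                  (s ^ (α - 1) * (exp (-b * K * t) * exp (-(b * K) * s))) :=
                mul_le_mul_of_nonneg_right (rpow_mul_one_add_rpow_le n hK htK hs)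
                  (by positivity)
              _ = _ := by ring
      _ = E * J * exp (-b * K * t) * (1 + K * t) ^ (-(3 : ℝ) / 4) := by
          rw [integral_const_mul]
          ring
      _ ≤ _ := by
          gcongr
          nlinarith [mul_nonneg hD0.le hI0]
end

section
/- Let n be a positive natural number, let b > 0, K > 0, and set α = n/4. Then there exists a constant C > 0 such that for every t with 0 < t ≤ 1/(2K), ∫₀^∞ s^{α-1} (t+s)^{-n/4} (1 + 2K(t+s))^{(n-3)/4} e^{-bK(t+s)} ds ≤ C e^{-bKt} (1 + |ln t|), and for every t ≥ 1/(2K), ∫₀^∞ s^{α-1} (t+s)^{-n/4} (1 + 2K(t+s))^{(n-3)/4} e^{-bK(t+s)} ds ≤ C e^{-bKt} (1 + Kt)^{-3/4}. -/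
open MeasureTheory Real Set

lemma rpow_le_const_mul_exp {α b y : ℝ} (hα : 0 < α) (hb : 0 < b) (hy : 0 ≤ y) :
    y ^ α ≤ (4 * α / b) ^ α * exp (b / 4 * y) := by
  have h1 : y ≤ 4 * α / b * exp (b / (4 * α) * y) := by
    have h := add_one_le_exp (b / (4 * α) * y)
    calc y = 4 * α / b * (b / (4 * α) * y) := by field_simp
      _ ≤ _ := by gcongr; linarith
  calc y ^ α ≤ (4 * α / b * exp (b / (4 * α) * y)) ^ α := rpow_le_rpow hy h1 hα.le
    _ = _ := by
      rw [mul_rpow (by positivity) (exp_pos _).le, ← exp_mul]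
      congr 2
      field_simp

/-- For `t` bounded below, the integrand is dominated by a Gamma integrand. -/
lemma integrand_le_of_large {α b K t s : ℝ} (hα : 0 < α) (hK : 0 < K)
    (ht : 1 / (2 * K) ≤ t) (hs : 0 < s) :
    s ^ (α - 1) * (t + s) ^ (-α) * (1 + 2 * K * (t + s)) ^ (α - 3 / 4) *
        exp (-b * K * (t + s)) ≤
      (4 * K) ^ α * exp (-b * K * t) * (1 + K * t) ^ (-(3 : ℝ) / 4) *
        (s ^ (α - 1) * exp (-(b * K * s))) := by
  have ht0 : 0 < t := lt_of_lt_of_le (by positivity) ht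
  have h1 : 1 ≤ 2 * K * t := by
    rw [div_le_iff₀ (by positivity)] at ht; linarith
  have hts : 0 < t + s := by positivity
  have hY : 0 < 1 + 2 * K * (t + s) := by positivity
  have hKs : 0 < K * s := by positivity
  have hsplit : (t + s) ^ (-α) * (1 + 2 * K * (t + s)) ^ (α - 3 / 4) ≤
      (4 * K) ^ α * (1 + K * t) ^ (-(3 : ℝ) / 4) := by
    have e1 : (1 + 2 * K * (t + s)) ^ (α - 3 / 4) =
        (1 + 2 * K * (t + s)) ^ α * (1 + 2 * K * (t + s)) ^ (-(3 : ℝ) / 4) := by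
      rw [← rpow_add hY]; congr 1; ring
    have e2 : (1 + 2 * K * (t + s)) ^ α ≤ (4 * K) ^ α * (t + s) ^ α := by
      rw [← mul_rpow (by positivity) hts.le]
      exact rpow_le_rpow hY.le (by nlinarith) hα.le
    have e3 : (1 + 2 * K * (t + s)) ^ (-(3 : ℝ) / 4) ≤ (1 + K * t) ^ (-(3 : ℝ) / 4) :=
      rpow_le_rpow_of_nonpos (by positivity) (by nlinarith) (by norm_num)
    have e4 : (t + s) ^ (-α) * (t + s) ^ α = 1 := by
      rw [← rpow_add hts]; simp
    calc _ ≤ (t + s) ^ (-α) * (((4 * K) ^ α * (t + s) ^ α) * (1 + K * t) ^ (-(3 : ℝ) / 4)) := by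
          rw [e1]; gcongr
      _ = ((t + s) ^ (-α) * (t + s) ^ α) * ((4 * K) ^ α * (1 + K * t) ^ (-(3 : ℝ) / 4)) := by ring
      _ = _ := by rw [e4, one_mul]
  have hexp : exp (-b * K * (t + s)) = exp (-b * K * t) * exp (-(b * K * s)) := by
    rw [← exp_add]; congr 1; ring
  rw [hexp]
  calc _ = ((t + s) ^ (-α) * (1 + 2 * K * (t + s)) ^ (α - 3 / 4)) *
        (s ^ (α - 1) * (exp (-b * K * t) * exp (-(b * K * s)))) := by ring
    _ ≤ ((4 * K) ^ α * (1 + K * t) ^ (-(3 : ℝ) / 4)) *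
        (s ^ (α - 1) * (exp (-b * K * t) * exp (-(b * K * s)))) := by gcongr
    _ = _ := by ring

lemma integral_le_of_large {α b K t : ℝ} (hα : 0 < α) (hb : 0 < b) (hK : 0 < K)
    (ht : 1 / (2 * K) ≤ t) :
    (∫ s in Ioi (0 : ℝ), s ^ (α - 1) * (t + s) ^ (-α) * (1 + 2 * K * (t + s)) ^ (α - 3 / 4) *
        exp (-b * K * (t + s))) ≤
      (4 * K) ^ α * ((1 / (b * K)) ^ α * Gamma α) * exp (-b * K * t) *
        (1 + K * t) ^ (-(3 : ℝ) / 4) := by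
  have ht0 : 0 < t := lt_of_lt_of_le (by positivity) ht
  have hG := integral_rpow_mul_exp_neg_mul_Ioi hα (mul_pos hb hK)
  have hint : IntegrableOn (fun s : ℝ => s ^ (α - 1) * exp (-(b * K * s))) (Ioi 0) := by
    by_contra h
    rw [integral_undef h] at hG
    have : 0 < (1 / (b * K)) ^ α * Gamma α := mul_pos (by positivity) (Gamma_pos_of_pos hα)
    linarith
  calc _ ≤ ∫ s in Ioi (0 : ℝ), (4 * K) ^ α * exp (-b * K * t) * (1 + K * t) ^ (-(3 : ℝ) / 4) *
        (s ^ (α - 1) * exp (-(b * K * s))) := by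
        refine integral_mono_of_nonneg ?_ (hint.const_mul _) ?_ <;>
          filter_upwards [ae_restrict_mem measurableSet_Ioi] with s hs
        · have : 0 < s := hs
          simp only [Pi.zero_apply]
          positivity
        · exact integrand_le_of_large hα hK ht hs
    _ = _ := by rw [integral_const_mul, hG]; ring

/-- For `t` bounded above, the integrand is dominated by a power on `(0, t]`, by `s⁻¹` on
`(t, 1 / (2K)]`, and by an exponential beyond. -/
lemma integrand_le_of_small {α b K t s : ℝ} (hα : 0 < α) (hb : 0 < b) (hK : 0 < K)
    (ht0 : 0 < t) (ht : t ≤ 1 / (2 * K)) (hs : 0 < s) :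
    s ^ (α - 1) * (t + s) ^ (-α) * (1 + 2 * K * (t + s)) ^ (α - 3 / 4) *
        exp (-b * K * (t + s)) ≤
      (4 * α / b) ^ α * exp (b / 2) * exp (-b * K * t) *
        ((Ioc 0 t).indicator (fun s => t ^ (-α) * s ^ (α - 1)) s +
          (Ioc t (1 / (2 * K))).indicator (fun s => s⁻¹) s +
          2 * K * exp (-(b * K / 2) * s)) := by
  have hts : 0 < t + s := by positivity
  have h2 : 2 * K * t ≤ 1 := by
    rw [le_div_iff₀ (by positivity)] at ht; linarith
  have hY : 1 ≤ 1 + 2 * K * (t + s) := by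
    have : 0 < 2 * K * (t + s) := by positivity
    linarith
  have hpow : (1 + 2 * K * (t + s)) ^ (α - 3 / 4) ≤
      (4 * α / b) ^ α * exp (b / 2) * exp (b * K / 2 * s) := by
    calc _ ≤ (1 + 2 * K * (t + s)) ^ α := rpow_le_rpow_of_exponent_le hY (by linarith)
      _ ≤ (2 + 2 * K * s) ^ α := rpow_le_rpow (by linarith) (by nlinarith) hα.le
      _ ≤ (4 * α / b) ^ α * exp (b / 4 * (2 + 2 * K * s)) :=
          rpow_le_const_mul_exp hα hb (by positivity)
      _ = _ := by rw [mul_assoc _ (exp (b / 2)), ← exp_add]; congr 2; ring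
  have hker : s ^ (α - 1) * (t + s) ^ (-α) * exp (-(b * K / 2) * s) ≤
      (Ioc 0 t).indicator (fun s => t ^ (-α) * s ^ (α - 1)) s +
          (Ioc t (1 / (2 * K))).indicator (fun s => s⁻¹) s +
          2 * K * exp (-(b * K / 2) * s) := by
    have hE : exp (-(b * K / 2) * s) ≤ 1 := by
      rw [exp_le_one_iff]
      have : 0 < b * K / 2 * s := by positivity
      linarith
    have hE0 : 0 ≤ 2 * K * exp (-(b * K / 2) * s) := by positivity
    have hinv : s ^ (α - 1) * (t + s) ^ (-α) ≤ s⁻¹ := by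
      calc _ ≤ s ^ (α - 1) * s ^ (-α) := by
            gcongr ?_ * ?_
            exact rpow_le_rpow_of_nonpos hs (by linarith) (by linarith)
        _ = s⁻¹ := by rw [← rpow_add hs, ← rpow_neg_one]; congr 1; ring
    by_cases hst : s ≤ t
    · have m1 : s ∈ Ioc 0 t := ⟨hs, hst⟩
      have m2 : s ∉ Ioc t (1 / (2 * K)) := fun h => absurd h.1 (not_lt.2 hst)
      rw [indicator_of_mem m1, indicator_of_notMem m2]
      have : s ^ (α - 1) * (t + s) ^ (-α) * exp (-(b * K / 2) * s) ≤
          t ^ (-α) * s ^ (α - 1) := by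
        calc _ ≤ s ^ (α - 1) * (t + s) ^ (-α) * 1 := by gcongr
          _ ≤ s ^ (α - 1) * t ^ (-α) * 1 := by
            gcongr ?_ * ?_ * _
            exact rpow_le_rpow_of_nonpos ht0 (by linarith) (by linarith)
          _ = _ := by ring
      linarith
    · have m1 : s ∉ Ioc 0 t := fun h => hst h.2
      rw [indicator_of_notMem m1]
      by_cases hsT : s ≤ 1 / (2 * K)
      · rw [indicator_of_mem (show s ∈ Ioc t (1 / (2 * K)) from ⟨not_le.1 hst, hsT⟩)]
        have : s ^ (α - 1) * (t + s) ^ (-α) * exp (-(b * K / 2) * s) ≤ s⁻¹ * 1 := by gcongr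
        linarith
      · rw [indicator_of_notMem (fun h => hsT h.2)]
        have hs' : s⁻¹ ≤ 2 * K := by
          rw [inv_le_comm₀ hs (by positivity), ← one_div]
          exact (not_le.1 hsT).le
        have : s ^ (α - 1) * (t + s) ^ (-α) * exp (-(b * K / 2) * s) ≤
            2 * K * exp (-(b * K / 2) * s) := by
          gcongr ?_ * _
          exact hinv.trans hs'
        linarith
  have hexp : exp (b * K / 2 * s) * exp (-b * K * (t + s)) =
      exp (-b * K * t) * exp (-(b * K / 2) * s) := by
    rw [← exp_add, ← exp_add]; congr 1; ring
  calc _ ≤ s ^ (α - 1) * (t + s) ^ (-α) *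
        ((4 * α / b) ^ α * exp (b / 2) * exp (b * K / 2 * s)) * exp (-b * K * (t + s)) := by
        gcongr
    _ = s ^ (α - 1) * (t + s) ^ (-α) * ((4 * α / b) ^ α * exp (b / 2)) *
        (exp (b * K / 2 * s) * exp (-b * K * (t + s))) := by ring
    _ = (4 * α / b) ^ α * exp (b / 2) * exp (-b * K * t) *
        (s ^ (α - 1) * (t + s) ^ (-α) * exp (-(b * K / 2) * s)) := by rw [hexp]; ring
    _ ≤ _ := by gcongr

lemma integral_le_of_small {α b K t : ℝ} (hα : 0 < α) (hb : 0 < b) (hK : 0 < K)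
    (ht0 : 0 < t) (ht : t ≤ 1 / (2 * K)) :
    (∫ s in Ioi (0 : ℝ), s ^ (α - 1) * (t + s) ^ (-α) * (1 + 2 * K * (t + s)) ^ (α - 3 / 4) *
        exp (-b * K * (t + s))) ≤
      (4 * α / b) ^ α * exp (b / 2) * (1 / α + |log (1 / (2 * K))| + 4 / b + 1) *
        exp (-b * K * t) * (1 + |log t|) := by
  have hT : 0 < 1 / (2 * K) := by positivity
  have hc : -(b * K / 2) < 0 := by
    have : 0 < b * K / 2 := by positivity
    linarith
  have i1 : IntegrableOn ((Ioc 0 t).indicator (fun s : ℝ => t ^ (-α) * s ^ (α - 1))) (Ioi 0) := by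
    refine IntegrableOn.integrable_indicator ?_ measurableSet_Ioc |>.integrableOn
    rw [← intervalIntegrable_iff_integrableOn_Ioc_of_le ht0.le]
    exact (intervalIntegral.intervalIntegrable_rpow' (by linarith)).const_mul _
  have i2 : IntegrableOn ((Ioc t (1 / (2 * K))).indicator (fun s : ℝ => s⁻¹)) (Ioi 0) := by
    refine IntegrableOn.integrable_indicator ?_ measurableSet_Ioc |>.integrableOn
    rw [← intervalIntegrable_iff_integrableOn_Ioc_of_le ht]
    refine intervalIntegral.intervalIntegrable_inv (fun x hx => ?_) continuousOn_id
    rw [uIcc_of_le ht] at hx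
    exact (ht0.trans_le hx.1).ne'
  have i3 : IntegrableOn (fun s : ℝ => 2 * K * exp (-(b * K / 2) * s)) (Ioi 0) :=
    (integrableOn_exp_mul_Ioi hc 0).const_mul _
  have v1 : ∫ s in Ioi (0 : ℝ), (Ioc 0 t).indicator (fun s : ℝ => t ^ (-α) * s ^ (α - 1)) s =
      1 / α := by
    rw [setIntegral_indicator measurableSet_Ioc, inter_eq_right.2 Ioc_subset_Ioi_self,
      ← intervalIntegral.integral_of_le ht0.le, intervalIntegral.integral_const_mul,
      integral_rpow (Or.inl (by linarith)), sub_add_cancel, zero_rpow hα.ne', sub_zero,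
      ← mul_div_assoc, ← rpow_add ht0, neg_add_cancel, rpow_zero]
  have v2 : ∫ s in Ioi (0 : ℝ), (Ioc t (1 / (2 * K))).indicator (fun s : ℝ => s⁻¹) s =
      log (1 / (2 * K)) - log t := by
    rw [setIntegral_indicator measurableSet_Ioc,
      inter_eq_right.2 (Ioc_subset_Ioi_self.trans (Ioi_subset_Ioi ht0.le)),
      ← intervalIntegral.integral_of_le ht, integral_inv_of_pos ht0 hT, log_div hT.ne' ht0.ne']
  have v3 : ∫ s in Ioi (0 : ℝ), 2 * K * exp (-(b * K / 2) * s) = 4 / b := by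
    rw [integral_const_mul, integral_exp_mul_Ioi hc]
    simp only [mul_zero, exp_zero]
    field_simp
    norm_num
  have hsum : 1 / α + (log (1 / (2 * K)) - log t) + 4 / b ≤
      (1 / α + |log (1 / (2 * K))| + 4 / b + 1) * (1 + |log t|) := by
    have h1 := le_abs_self (log (1 / (2 * K)))
    have h2 := neg_abs_le (log t)
    have h3 : 0 ≤ (1 / α + |log (1 / (2 * K))| + 4 / b) * |log t| := by positivity
    linarith
  calc _ ≤ ∫ s in Ioi (0 : ℝ), (4 * α / b) ^ α * exp (b / 2) * exp (-b * K * t) *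
        ((Ioc 0 t).indicator (fun s => t ^ (-α) * s ^ (α - 1)) s +
          (Ioc t (1 / (2 * K))).indicator (fun s => s⁻¹) s +
          2 * K * exp (-(b * K / 2) * s)) := by
        refine integral_mono_of_nonneg ?_ (((i1.add i2).add i3).const_mul _) ?_ <;>
          filter_upwards [ae_restrict_mem measurableSet_Ioi] with s hs
        · have : 0 < s := hs
          simp only [Pi.zero_apply]
          positivity
        · exact integrand_le_of_small hα hb hK ht0 ht hs
    _ = (4 * α / b) ^ α * exp (b / 2) * exp (-b * K * t) *
        (1 / α + (log (1 / (2 * K)) - log t) + 4 / b) := by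
        rw [integral_const_mul, ← v1, ← v2, ← v3, ← integral_add i1 i2]
        congr 1
        exact integral_add (i1.add i2) i3
    _ ≤ (4 * α / b) ^ α * exp (b / 2) * exp (-b * K * t) *
        ((1 / α + |log (1 / (2 * K))| + 4 / b + 1) * (1 + |log t|)) := by gcongr
    _ = _ := by ring

open MeasureTheory Real Set

/-- Integral estimate underlying Lemma 2.8, critical regime `α = n/4`. -/
theorem integral_estimate_critical (n : ℕ) (hn : 0 < n) (b K α : ℝ)
    (hb : 0 < b) (hK : 0 < K) (hα : α = (n : ℝ) / 4) :
    ∃ C > (0:ℝ),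
      (∀ t : ℝ, 0 < t → t ≤ 1 / (2 * K) →
        (∫ s in Ioi (0:ℝ), s ^ (α - 1) * (t + s) ^ (-(n : ℝ) / 4) *
            (1 + 2 * K * (t + s)) ^ (((n : ℝ) - 3) / 4) * Real.exp (-b * K * (t + s)))
          ≤ C * Real.exp (-b * K * t) * (1 + |Real.log t|)) ∧
      (∀ t : ℝ, 1 / (2 * K) ≤ t →
        (∫ s in Ioi (0:ℝ), s ^ (α - 1) * (t + s) ^ (-(n : ℝ) / 4) *
            (1 + 2 * K * (t + s)) ^ (((n : ℝ) - 3) / 4) * Real.exp (-b * K * (t + s)))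
          ≤ C * Real.exp (-b * K * t) * (1 + K * t) ^ (-(3:ℝ) / 4)) := by
  have hα0 : 0 < α := by rw [hα]; positivity
  have e1 : -(n : ℝ) / 4 = -α := by rw [hα]; ring
  have e2 : ((n : ℝ) - 3) / 4 = α - 3 / 4 := by rw [hα]; ring
  rw [e1, e2]
  refine ⟨max ((4 * α / b) ^ α * exp (b / 2) * (1 / α + |log (1 / (2 * K))| + 4 / b + 1))
    ((4 * K) ^ α * ((1 / (b * K)) ^ α * Gamma α)), lt_max_of_lt_left (by positivity),
    fun t ht0 ht => (integral_le_of_small hα0 hb hK ht0 ht).trans ?_,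
    fun t ht => (integral_le_of_large hα0 hb hK ht).trans ?_⟩
  · gcongr
    exact le_max_left _ _
  · have ht0 : 0 < t := lt_of_lt_of_le (by positivity) ht
    gcongr
    exact le_max_right _ _
end

section
/- Let n be a positive natural number, let b > 0, K > 0, and let α be real with α > n/4. Then there exists a constant C > 0 such that for every t with 0 < t ≤ 1/(2K), ∫₀^∞ s^{α-1} (t+s)^{-n/4} (1 + 2K(t+s))^{(n-3)/4} e^{-bK(t+s)} ds ≤ C e^{-bKt}, and for every t ≥ 1/(2K), ∫₀^∞ s^{α-1} (t+s)^{-n/4} (1 + 2K(t+s))^{(n-3)/4} e^{-bK(t+s)} ds ≤ C e^{-bKt} (1 + Kt)^{-3/4}. -/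
/-- A power of `1 + 2 K s` of exponent at most `n` is dominated by an exponential. -/
lemma rpow_le_mul_exp_half (n : ℕ) {b K s p : ℝ} (hb : 0 < b) (hK : 0 < K) (hs : 0 < s)
    (hp : p ≤ n) :
    (1 + 2 * K * s) ^ p ≤
      (n.factorial * Real.exp (b / 4) / (b / 4) ^ n) * Real.exp (b * K / 2 * s) := by
  have hKs : 0 < K * s := mul_pos hK hs
  have h1 : (1:ℝ) ≤ 1 + 2 * K * s := by nlinarith
  have h2 : (1 + 2 * K * s) ^ p ≤ (1 + 2 * K * s) ^ n := by
    rw [← Real.rpow_natCast]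
    exact Real.rpow_le_rpow_of_exponent_le h1 hp
  have h3 := Real.pow_div_factorial_le_exp (b / 4 * (1 + 2 * K * s)) (by positivity) n
  have h4 : Real.exp (b / 4 * (1 + 2 * K * s)) =
      Real.exp (b / 4) * Real.exp (b * K / 2 * s) := by
    rw [← Real.exp_add]; ring_nf
  rw [h4, div_le_iff₀ (by positivity), mul_pow] at h3
  refine h2.trans ?_
  rw [div_mul_eq_mul_div, le_div_iff₀ (by positivity)]
  linarith

/-- The heat kernel factor at time `t + s` is controlled by the one at time `s`, up to the
decay `(1 + K t) ^ (-3/4)`. -/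
lemma rpow_mul_rpow_add_le {K s t p : ℝ} (hK : 0 < K) (hs : 0 < s) (ht : 0 < t) (hp : 0 ≤ p) :
    (t + s) ^ (-p) * (1 + 2 * K * (t + s)) ^ (p - 3 / 4) ≤
      s ^ (-p) * (1 + 2 * K * s) ^ p * (1 + K * t) ^ (-(3:ℝ) / 4) := by
  have hu : 0 < t + s := by positivity
  have hKs : 0 < K * s := mul_pos hK hs
  have hKt : 0 < K * t := mul_pos hK ht
  have hx : 0 < 1 + 2 * K * (t + s) := by positivity
  have split {u : ℝ} (hu : 0 < u) :
      u ^ (-p) * (1 + 2 * K * u) ^ p = ((1 + 2 * K * u) / u) ^ p := by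
    rw [Real.div_rpow (by positivity) hu.le, Real.rpow_neg hu.le]
    ring
  rw [sub_eq_add_neg, Real.rpow_add hx, ← mul_assoc, split hu, split hs, ← neg_div]
  refine mul_le_mul ?_ ?_ (by positivity) (by positivity)
  · refine Real.rpow_le_rpow (by positivity) ?_ hp
    rw [div_le_div_iff₀ hu hs]
    nlinarith
  · exact Real.rpow_le_rpow_of_nonpos (by positivity) (by nlinarith) (by norm_num)

open MeasureTheory Real Set

/-- Integral estimate underlying Lemma 2.8, regime `α > n/4`. -/
theorem integral_estimate_supercritical (n : ℕ) (hn : 0 < n) (b K α : ℝ)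
    (hb : 0 < b) (hK : 0 < K) (hα : (n : ℝ) / 4 < α) :
    ∃ C > (0:ℝ),
      (∀ t : ℝ, 0 < t → t ≤ 1 / (2 * K) →
        (∫ s in Ioi (0:ℝ), s ^ (α - 1) * (t + s) ^ (-(n : ℝ) / 4) *
            (1 + 2 * K * (t + s)) ^ (((n : ℝ) - 3) / 4) * Real.exp (-b * K * (t + s)))
          ≤ C * Real.exp (-b * K * t)) ∧
      (∀ t : ℝ, 1 / (2 * K) ≤ t →
        (∫ s in Ioi (0:ℝ), s ^ (α - 1) * (t + s) ^ (-(n : ℝ) / 4) *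
            (1 + 2 * K * (t + s)) ^ (((n : ℝ) - 3) / 4) * Real.exp (-b * K * (t + s)))
          ≤ C * Real.exp (-b * K * t) * (1 + K * t) ^ (-(3:ℝ) / 4)) := by
  set M : ℝ := n.factorial * Real.exp (b / 4) / (b / 4) ^ n with hM
  have hMpos : 0 < M := by positivity
  have hc : 0 < b * K / 2 := by positivity
  set g : ℝ → ℝ := fun s => s ^ (α - n / 4 - 1) * Real.exp (-(b * K / 2 * s)) with hg
  have hgint : IntegrableOn g (Ioi 0) := by
    have := integrableOn_rpow_mul_exp_neg_mul_rpow (p := 1) (s := α - n / 4 - 1)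
      (by linarith) one_pos hc
    simpa [hg, neg_mul] using this
  have hgpos : 0 < ∫ s in Ioi (0:ℝ), g s := by
    rw [hg, Real.integral_rpow_mul_exp_neg_mul_Ioi (by linarith) hc]
    have := Real.Gamma_pos_of_pos (sub_pos.2 hα)
    positivity
  have key (t : ℝ) (ht : 0 < t) :
      (∫ s in Ioi (0:ℝ), s ^ (α - 1) * (t + s) ^ (-(n : ℝ) / 4) *
            (1 + 2 * K * (t + s)) ^ (((n : ℝ) - 3) / 4) * Real.exp (-b * K * (t + s)))
          ≤ (M * ∫ s in Ioi (0:ℝ), g s) * Real.exp (-b * K * t) *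
            (1 + K * t) ^ (-(3:ℝ) / 4) := by
    have hKt : 0 < K * t := mul_pos hK ht
    set D : ℝ := M * Real.exp (-b * K * t) * (1 + K * t) ^ (-(3:ℝ) / 4) with hD
    have hmono : (∫ s in Ioi (0:ℝ), s ^ (α - 1) * (t + s) ^ (-(n : ℝ) / 4) *
            (1 + 2 * K * (t + s)) ^ (((n : ℝ) - 3) / 4) * Real.exp (-b * K * (t + s)))
          ≤ ∫ s in Ioi (0:ℝ), D * g s := by
      refine integral_mono_of_nonneg ?_ (hgint.const_mul D) ?_
      · filter_upwards [ae_restrict_mem measurableSet_Ioi] with s hs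
        have hs : 0 < s := hs
        simp only [Pi.zero_apply]
        positivity
      · filter_upwards [ae_restrict_mem measurableSet_Ioi] with s hs
        have hs : 0 < s := hs
        have h1 := rpow_mul_rpow_add_le (p := (n:ℝ) / 4) hK hs ht (by positivity)
        have h2 := rpow_le_mul_exp_half n (p := (n:ℝ) / 4) hb hK hs
          (by linarith [(Nat.cast_nonneg n : (0:ℝ) ≤ n)])
        rw [← hM] at h2
        have e1 : Real.exp (-b * K * (t + s)) = Real.exp (-b * K * t) *
            (Real.exp (-(b * K / 2 * s)) * Real.exp (-(b * K / 2 * s))) := by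
          rw [← Real.exp_add, ← Real.exp_add]; ring_nf
        have e2 : Real.exp (b * K / 2 * s) * Real.exp (-(b * K / 2 * s)) = 1 := by
          rw [← Real.exp_add]; simp
        have e3 : s ^ (α - n / 4 - 1) = s ^ (α - 1) * s ^ (-((n:ℝ) / 4)) := by
          rw [← Real.rpow_add hs]; ring_nf
        calc _ = s ^ (α - 1) * ((t + s) ^ (-((n : ℝ) / 4)) *
              (1 + 2 * K * (t + s)) ^ ((n : ℝ) / 4 - 3 / 4)) *
              Real.exp (-b * K * (t + s)) := by
                rw [neg_div, sub_div]; ring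
          _ ≤ s ^ (α - 1) * (s ^ (-((n:ℝ) / 4)) * (M * Real.exp (b * K / 2 * s)) *
              (1 + K * t) ^ (-(3:ℝ) / 4)) * Real.exp (-b * K * (t + s)) := by
                gcongr _ * ?_ * _
                refine h1.trans ?_
                gcongr
          _ = D * g s * (Real.exp (b * K / 2 * s) * Real.exp (-(b * K / 2 * s))) := by
                rw [e1, hD, hg]
                simp only [e3]
                ring
          _ = D * g s := by rw [e2, mul_one]
    rw [integral_const_mul] at hmono
    refine hmono.trans (le_of_eq ?_)
    rw [hD]; ring
  refine ⟨M * ∫ s in Ioi (0:ℝ), g s, by positivity, fun t ht _ => ?_, fun t ht => ?_⟩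
  · refine (key t ht).trans (mul_le_of_le_one_right (by positivity) ?_)
    exact Real.rpow_le_one_of_one_le_of_nonpos (by nlinarith [mul_pos hK ht]) (by norm_num)
  · exact key t (lt_of_lt_of_le (by positivity) ht)
end

section
/- Let n be a natural number with n ≥ 1, let K > 0, and let α be real with α < n/2. Define g(z) := exp(-(n-1)√K z / 2) · (2 + √K z)^{-3/2} · (Kz²/4)^{α - n/2} · Γ(n/2 - α, Kz²/4) for z > 0, where Γ(s, x) := ∫_x^∞ t^{s-1} e^{-t} dt is the upper incomplete Gamma function. Then g is strictly decreasing on (0, ∞). -/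
open MeasureTheory Real Set

/-- The upper incomplete Gamma function `Γ(s, x) = ∫_x^∞ t^{s-1} e^{-t} dt`. -/
noncomputable def upperIncompleteGamma (s x : ℝ) : ℝ :=
  ∫ t in Set.Ioi x, t ^ (s - 1) * Real.exp (-t)

theorem integrableOn_upperIncompleteGamma {s x : ℝ} (hs : 0 < s) (hx : 0 ≤ x) :
    IntegrableOn (fun t : ℝ => t ^ (s - 1) * Real.exp (-t)) (Ioi x) := by
  have h := (Real.GammaIntegral_convergent hs).mono_set (Ioi_subset_Ioi hx)
  simpa only [mul_comm] using h

theorem upperIncompleteGamma_pos {s x : ℝ} (hs : 0 < s) (hx : 0 ≤ x) :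
    0 < upperIncompleteGamma s x := by
  have hpos : ∀ t ∈ Ioi x, 0 < t ^ (s - 1) * Real.exp (-t) := fun t ht =>
    mul_pos (Real.rpow_pos_of_pos (hx.trans_lt ht) _) (Real.exp_pos _)
  rw [upperIncompleteGamma, setIntegral_pos_iff_support_of_nonneg_ae
    (ae_restrict_of_forall_mem measurableSet_Ioi fun t ht => (hpos t ht).le)
    (integrableOn_upperIncompleteGamma hs hx), Set.inter_eq_self_of_subset_right
    fun t ht => Function.mem_support.2 (hpos t ht).ne']
  simp

theorem upperIncompleteGamma_antitoneOn {s : ℝ} (hs : 0 < s) :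
    AntitoneOn (upperIncompleteGamma s) (Ici 0) := fun _ hx _ _ hxy =>
  setIntegral_mono_set (integrableOn_upperIncompleteGamma hs hx)
    (ae_restrict_of_forall_mem measurableSet_Ioi fun _ ht =>
      mul_nonneg (Real.rpow_nonneg ((mem_Ici.1 hx).trans (mem_Ioi.1 ht).le) _)
        (Real.exp_pos _).le)
    (Ioi_subset_Ioi hxy).eventuallyLE

/-- `x ↦ x ^ (-s) * Γ(s, x)` is strictly decreasing on `(0, ∞)` for `s > 0`. -/
theorem rpow_neg_mul_upperIncompleteGamma_strictAntiOn {s : ℝ} (hs : 0 < s) :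
    StrictAntiOn (fun x => x ^ (-s) * upperIncompleteGamma s x) (Ioi 0) :=
  fun _ hx _ hy hxy =>
  mul_lt_mul (Real.rpow_lt_rpow_of_neg hx hxy (neg_lt_zero.2 hs))
    (upperIncompleteGamma_antitoneOn hs (mem_Ioi.1 hx).le (mem_Ioi.1 hy).le hxy.le)
    (upperIncompleteGamma_pos hs (mem_Ioi.1 hy).le) (Real.rpow_pos_of_pos hx _).le

/-- The lower-bound profile `Ḡ_α` of Lemma 4.2 is strictly decreasing on `(0, ∞)`
(case `α < n/2`). -/
theorem profile_strictAnti (n : ℕ) (hn : 1 ≤ n) (K α : ℝ) (hK : 0 < K)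
    (hα : α < (n : ℝ) / 2)
    (g : ℝ → ℝ)
    (hg : ∀ z : ℝ, g z =
      Real.exp (-((n : ℝ) - 1) * Real.sqrt K * z / 2) *
        (2 + Real.sqrt K * z) ^ (-(3:ℝ) / 2) *
        (K * z ^ 2 / 4) ^ (α - (n : ℝ) / 2) *
        upperIncompleteGamma ((n : ℝ) / 2 - α) (K * z ^ 2 / 4)) :
    StrictAntiOn g (Ioi 0) := by
  have hs : 0 < (n : ℝ) / 2 - α := sub_pos.2 hα
  have hn' : (0 : ℝ) ≤ n - 1 := sub_nonneg.2 (by exact_mod_cast hn)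
  intro a ha b hb hab
  rw [mem_Ioi] at ha hb
  have hxa : 0 < K * a ^ 2 / 4 := by positivity
  have hxb : 0 < K * b ^ 2 / 4 := by positivity
  have hx : K * a ^ 2 / 4 < K * b ^ 2 / 4 := by gcongr
  have hexp : Real.exp (-((n : ℝ) - 1) * Real.sqrt K * b / 2) ≤
      Real.exp (-((n : ℝ) - 1) * Real.sqrt K * a / 2) := by
    have := mul_le_mul_of_nonneg_left hab.le (mul_nonneg hn' (Real.sqrt_nonneg K))
    exact Real.exp_le_exp.2 (by linarith)
  have hpow : (2 + Real.sqrt K * b) ^ (-(3:ℝ) / 2) ≤ (2 + Real.sqrt K * a) ^ (-(3:ℝ) / 2) :=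
    Real.rpow_le_rpow_of_nonpos (by positivity) (by gcongr) (by norm_num)
  have hΓ := rpow_neg_mul_upperIncompleteGamma_strictAntiOn hs hxa hxb hx
  simp only [neg_sub] at hΓ
  have hΓb := upperIncompleteGamma_pos hs hxb.le
  rw [hg, hg, mul_assoc _ _ (upperIncompleteGamma _ _), mul_assoc _ _ (upperIncompleteGamma _ _)]
  exact mul_lt_mul' (mul_le_mul hexp hpow (by positivity) (by positivity)) hΓ
    (by positivity) (by positivity)
end
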